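/- Let ℬ be a Markushevich basis of 𝕏, w a weight, and 0 < s ≤ 1. If ℬ is s-w-semi-greedy, then for every 0 < t ≤ 1 there exists a constant C(s,t) > 0 such that for every x ∈ 𝕏, every m ∈ ℕ, and every A ∈ 𝒢(x,m,t), there is y ∈ 𝕏 with supp(y) ⊆ A and ‖x − y‖ ≤ C(s,t)·inf{‖x − z‖ : z ∈ 𝕏, w(supp(z)) ≤ w(A)} (with no finiteness restriction on supp(z)). In particular, ℬ is t-w-semi-greedy for every 0 < t ≤ 1. -/

import Mathlib

open scoped BigOperators ENNReal
open Filter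

noncomputable section

namespace GreedyPaper

variable {𝕜 : Type*} [RCLike 𝕜] {X : Type*} [NormedAddCommGroup X] [NormedSpace 𝕜 X]

/-- Support of `x` with respect to the coordinate functionals `f`. -/
def msupp (f : ℕ → X →L[𝕜] 𝕜) (x : X) : Set ℕ := {i | f i x ≠ 0}

/-- Projection onto a finite set of coordinates. -/
def proj (e : ℕ → X) (f : ℕ → X →L[𝕜] 𝕜) (A : Finset ℕ) (x : X) : X :=
  ∑ i ∈ A, f i x • e i

/-- `A` is an `m`-`t`-greedy set for `x`: `|A| = m` and
`min_{j ∈ A} |f j x| ≥ t · sup_{k ∉ A} |f k x|`. -/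
def GreedySet (f : ℕ → X →L[𝕜] 𝕜) (x : X) (m : ℕ) (t : ℝ) (A : Finset ℕ) : Prop :=
  A.card = m ∧ ∀ j ∈ A, ∀ k ∉ A, t * ‖f k x‖ ≤ ‖f j x‖

/-- `w`-measure of a set of indices, with value in `ℝ≥0∞` (possibly infinite). -/
def wsum (w : ℕ → ℝ) (S : Set ℕ) : ℝ≥0∞ := ∑' i : S, ENNReal.ofReal (w i)

/-- Sign of a scalar: `sgn 0 = 1` and `sgn t * t = |t|`. -/
def sgn (t : 𝕜) : 𝕜 := if t = 0 then 1 else (‖t‖ : 𝕜) / t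

/-- A Markushevich basis (with the boundedness assumptions of the paper):
biorthogonality, dense span, totality of the coordinate functionals, and boundedness
of both the basis vectors and the coordinate functionals. -/
structure IsMarkushevichBasis (e : ℕ → X) (f : ℕ → X →L[𝕜] 𝕜) : Prop where
  biorth : ∀ i j, f i (e j) = if i = j then 1 else 0
  dense_span : Dense ((Submodule.span 𝕜 (Set.range e) : Submodule 𝕜 X) : Set X)
  total : ∀ x : X, (∀ i, f i x = 0) → x = 0
  bddE : BddAbove (Set.range fun i => ‖e i‖)
  bddF : BddAbove (Set.range fun i => ‖f i‖)

/-- `ℬ` is `C`-`s`-`w`-semi-greedy: for every `x` and `m` there are an `m`-`s`-greedy set `A`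
and `y` supported in `A` with `‖x - y‖ ≤ C · inf {‖x - z‖ : supp z finite, w(supp z) ≤ w(A)}`. -/
def SemiGreedy (e : ℕ → X) (f : ℕ → X →L[𝕜] 𝕜) (w : ℕ → ℝ) (C s : ℝ) : Prop :=
  ∀ (x : X) (m : ℕ), ∃ A : Finset ℕ, GreedySet f x m s A ∧
    ∃ y : X, msupp f y ⊆ (A : Set ℕ) ∧
      ∀ z : X, (msupp f z).Finite → wsum w (msupp f z) ≤ wsum w (A : Set ℕ) →
        ‖x - y‖ ≤ C * ‖x - z‖

/-- `ℬ` is `C`-`s`-`w`-almost semi-greedy. -/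
def AlmostSemiGreedy (e : ℕ → X) (f : ℕ → X →L[𝕜] 𝕜) (w : ℕ → ℝ) (C s : ℝ) : Prop :=
  ∀ (x : X) (m : ℕ), ∃ A : Finset ℕ, GreedySet f x m s A ∧
    ∃ y : X, msupp f y ⊆ (A : Set ℕ) ∧
      ∀ B : Finset ℕ, wsum w (B : Set ℕ) ≤ wsum w (A : Set ℕ) →
        ‖x - y‖ ≤ C * ‖x - proj e f B x‖

/-- `ℬ` is `C`-`w`-almost greedy. -/
def AlmostGreedy (e : ℕ → X) (f : ℕ → X →L[𝕜] 𝕜) (w : ℕ → ℝ) (C : ℝ) : Prop :=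
  ∀ (x : X) (m : ℕ) (A : Finset ℕ), GreedySet f x m 1 A →
    ∀ B : Finset ℕ, wsum w (B : Set ℕ) ≤ wsum w (A : Set ℕ) →
      ‖x - proj e f A x‖ ≤ C * ‖x - proj e f B x‖

/-- `ℬ` is `C`-`w`-disjoint almost greedy. -/
def DisjointAlmostGreedy (e : ℕ → X) (f : ℕ → X →L[𝕜] 𝕜) (w : ℕ → ℝ) (C : ℝ) : Prop :=
  ∀ (x : X) (m : ℕ) (A : Finset ℕ), GreedySet f x m 1 A →
    ∀ B : Finset ℕ, wsum w (B : Set ℕ) ≤ wsum w (A : Set ℕ) → Disjoint B A →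
      ‖x - proj e f A x‖ ≤ C * ‖x - proj e f B x‖

/-- `ℬ` is `C`-`s`-`w`-almost greedy in the weak sense. -/
def WeakAlmostGreedy (e : ℕ → X) (f : ℕ → X →L[𝕜] 𝕜) (w : ℕ → ℝ) (C s : ℝ) : Prop :=
  ∀ (x : X) (m : ℕ), ∃ A : Finset ℕ, GreedySet f x m s A ∧
    ∀ B : Finset ℕ, wsum w (B : Set ℕ) ≤ wsum w (A : Set ℕ) →
      ‖x - proj e f A x‖ ≤ C * ‖x - proj e f B x‖

/-- `ℬ` is `C`-`w`-superdemocratic. -/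
def SuperDemocratic (e : ℕ → X) (f : ℕ → X →L[𝕜] 𝕜) (w : ℕ → ℝ) (C : ℝ) : Prop :=
  ∀ (A B : Finset ℕ) (ε ε' : ℕ → 𝕜), (∀ i ∈ A, ‖ε i‖ = 1) → (∀ i ∈ B, ‖ε' i‖ = 1) →
    wsum w (A : Set ℕ) ≤ wsum w (B : Set ℕ) →
      ‖∑ i ∈ A, ε i • e i‖ ≤ C * ‖∑ i ∈ B, ε' i • e i‖

/-- `ℬ` is `C`-`w`-democratic. -/
def Democratic (e : ℕ → X) (f : ℕ → X →L[𝕜] 𝕜) (w : ℕ → ℝ) (C : ℝ) : Prop :=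
  ∀ A B : Finset ℕ, wsum w (A : Set ℕ) ≤ wsum w (B : Set ℕ) →
    ‖∑ i ∈ A, e i‖ ≤ C * ‖∑ i ∈ B, e i‖

/-- `ℬ` is `C`-truncation quasi-greedy. -/
def TruncationQuasiGreedy (e : ℕ → X) (f : ℕ → X →L[𝕜] 𝕜) (C : ℝ) : Prop :=
  ∀ (x : X) (m : ℕ) (A : Finset ℕ) (hA : A.Nonempty), GreedySet f x m 1 A →
    (A.inf' hA fun i => ‖f i x‖) * ‖∑ i ∈ A, sgn (f i x) • e i‖ ≤ C * ‖x‖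

/-- `ℬ` has the `C`-`w`-Property (A). -/
def PropertyA (e : ℕ → X) (f : ℕ → X →L[𝕜] 𝕜) (w : ℕ → ℝ) (C : ℝ) : Prop :=
  ∀ x : X, (∀ i, ‖f i x‖ ≤ 1) →
    ∀ A B : Finset ℕ, wsum w (A : Set ℕ) ≤ wsum w (B : Set ℕ) → Disjoint A B →
      (∀ i ∈ A ∪ B, f i x = 0) →
      ∀ ε ε' : ℕ → 𝕜, (∀ i ∈ A, ‖ε i‖ = 1) → (∀ i ∈ B, ‖ε' i‖ = 1) →
        ‖x + ∑ i ∈ A, ε i • e i‖ ≤ C * ‖x + ∑ i ∈ B, ε' i • e i‖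

/-- The finite dimensional separation property (FDSP) with constant `M`. -/
def FDSP (e : ℕ → X) (M : ℝ) : Prop :=
  ∀ Z : Submodule 𝕜 X, IsClosed (Z : Set X) → TopologicalSpace.IsSeparable (Z : Set X) →
    ∀ ε : ℝ, 0 < ε → ∃ k : ℕ → ℕ, StrictMono k ∧
      (∀ (a : ℕ → 𝕜) (n l : ℕ), n ≤ l →
        ‖∑ j ∈ Finset.range (n + 1), a j • e (k j)‖ ≤
          (M + ε) * ‖∑ j ∈ Finset.range (l + 1), a j • e (k j)‖) ∧
      (∀ F : Submodule 𝕜 X, F ≤ Z → FiniteDimensional 𝕜 F →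
        ∃ N : ℕ, ∀ x ∈ F,
          ∀ z ∈ closure ((Submodule.span 𝕜 {v : X | ∃ n, N < n ∧ v = e (k n)} :
              Submodule 𝕜 X) : Set X),
            ‖x‖ ≤ (M + ε) * ‖x + z‖)

/-- `v` is a block basis of `e`. -/
def IsBlockBasis (e v : ℕ → X) : Prop :=
  ∃ (b : ℕ → 𝕜) (n m : ℕ → ℕ), (∀ i, n i ≤ m i) ∧ (∀ i, m i < n (i + 1)) ∧
    (∀ i, v i = ∑ k ∈ Finset.Icc (n i) (m i), b k • e k) ∧
    (∀ i, ∃ k ∈ Finset.Icc (n i) (m i), b k ≠ 0)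

section Expansions

variable {e : ℕ → X} {f : ℕ → X →L[𝕜] 𝕜}

lemma IsMarkushevichBasis.exists_bound (hb : IsMarkushevichBasis e f) :
    ∃ M : ℝ, 1 ≤ M ∧ (∀ i, ‖e i‖ ≤ M) ∧ ∀ i x, ‖f i x‖ ≤ M * ‖x‖ := by
  obtain ⟨a, ha⟩ := hb.bddE
  obtain ⟨b, hb'⟩ := hb.bddF
  refine ⟨max 1 (max a b), le_max_left _ _, fun i => ?_, fun i x => ?_⟩
  · exact (ha ⟨i, rfl⟩).trans ((le_max_left _ _).trans (le_max_right _ _))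
  · refine (f i).le_of_opNorm_le ?_ x
    exact (hb' ⟨i, rfl⟩).trans ((le_max_right _ _).trans (le_max_right _ _))

lemma IsMarkushevichBasis.coeff_sum (hb : IsMarkushevichBasis e f) (A : Finset ℕ) (c : ℕ → 𝕜)
    (i : ℕ) : f i (∑ j ∈ A, c j • e j) = if i ∈ A then c i else 0 := by
  simp [map_sum, hb.biorth]

lemma IsMarkushevichBasis.msupp_sum_subset (hb : IsMarkushevichBasis e f) (A : Finset ℕ)
    (c : ℕ → 𝕜) : msupp f (∑ j ∈ A, c j • e j) ⊆ (A : Set ℕ) := by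
  intro i hi
  by_contra h
  exact hi (by rw [hb.coeff_sum, if_neg (by simpa using h)])

lemma IsMarkushevichBasis.eq_sum_of_msupp_subset (hb : IsMarkushevichBasis e f) {A : Finset ℕ}
    {y : X} (hy : msupp f y ⊆ (A : Set ℕ)) : y = ∑ j ∈ A, f j y • e j := by
  refine sub_eq_zero.1 (hb.total _ fun i => ?_)
  rw [map_sub, hb.coeff_sum]
  split_ifs with h
  · simp
  · have : f i y = 0 := by
      by_contra h'
      exact h (by simpa using hy h')
    simp [this]

lemma IsMarkushevichBasis.tendsto_coeff (hb : IsMarkushevichBasis e f) (x : X) :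
    Tendsto (fun i => ‖f i x‖) cofinite (nhds 0) := by
  obtain ⟨M, hM1, -, hM⟩ := hb.exists_bound
  rw [Metric.tendsto_nhds]
  intro ε hε
  obtain ⟨v, hv, hxv⟩ := Metric.mem_closure_iff.1 (hb.dense_span x) (ε / M) (by positivity)
  have hfin : ∀ᶠ i in cofinite, f i v = 0 := by
    refine Submodule.span_induction (p := fun v _ => ∀ᶠ i in cofinite, f i v = 0)
      ?_ ?_ ?_ ?_ hv
    · rintro _ ⟨j, rfl⟩
      filter_upwards [(Set.finite_singleton j).compl_mem_cofinite] with i hi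
      rw [hb.biorth, if_neg (by simpa using hi)]
    · simp
    · intro a b _ _ ha hb'
      filter_upwards [ha, hb'] with i h1 h2
      simp [h1, h2]
    · intro c a _ ha
      filter_upwards [ha] with i h1
      simp [h1]
  filter_upwards [hfin] with i hi
  have h1 : ‖f i x‖ ≤ M * ‖x - v‖ := by
    simpa [hi] using hM i (x - v)
  rw [dist_eq_norm] at hxv
  have h2 : M * ‖x - v‖ < ε := by
    rw [lt_div_iff₀ (by positivity)] at hxv
    linarith
  simpa using h1.trans_lt h2

lemma IsMarkushevichBasis.finite_le_coeff (hb : IsMarkushevichBasis e f) (x : X) {a : ℝ}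
    (ha : 0 < a) : {i | a ≤ ‖f i x‖}.Finite := by
  have h := (hb.tendsto_coeff x).eventually_lt_const ha
  rw [Filter.eventually_cofinite] at h
  simpa using h

lemma IsMarkushevichBasis.exists_max_coeff (hb : IsMarkushevichBasis e f) (x : X)
    (A : Finset ℕ) : ∃ k ∉ A, ∀ j ∉ A, ‖f j x‖ ≤ ‖f k x‖ := by
  by_cases h : ∃ k ∉ A, f k x ≠ 0
  · obtain ⟨k₀, hk₀, hne⟩ := h
    have hpos : 0 < ‖f k₀ x‖ := norm_pos_iff.2 hne
    have hfin : {i | ‖f k₀ x‖ ≤ ‖f i x‖ ∧ i ∉ A}.Finite :=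
      (hb.finite_le_coeff x hpos).subset fun i hi => hi.1
    obtain ⟨k, hk, hmax⟩ := Set.exists_max_image _ (fun i => ‖f i x‖) hfin ⟨k₀, le_rfl, hk₀⟩
    refine ⟨k, hk.2, fun j hj => ?_⟩
    by_cases hj' : ‖f k₀ x‖ ≤ ‖f j x‖
    · exact hmax j ⟨hj', hj⟩
    · exact (not_le.1 hj').le.trans hk.1
  · push Not at h
    obtain ⟨k, hk⟩ := Infinite.exists_notMem_finset A
    exact ⟨k, hk, fun j hj => by simp [h j hj]⟩

lemma IsMarkushevichBasis.exists_greedySet (hb : IsMarkushevichBasis e f) (x : X) (m : ℕ)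
    {t : ℝ} (ht : t ≤ 1) : ∃ A, GreedySet f x m t A := by
  suffices h : ∃ A : Finset ℕ, A.card = m ∧ ∀ j ∈ A, ∀ k ∉ A, ‖f k x‖ ≤ ‖f j x‖ by
    obtain ⟨A, hA, h⟩ := h
    exact ⟨A, hA, fun j hj k hk =>
      (mul_le_of_le_one_left (norm_nonneg _) ht).trans (h j hj k hk)⟩
  induction m with
  | zero => exact ⟨∅, by simp⟩
  | succ m ih =>
    obtain ⟨A, hA, h⟩ := ih
    obtain ⟨k, hk, hmax⟩ := hb.exists_max_coeff x A
    refine ⟨insert k A, by simp [hk, hA], fun j hj i hi => ?_⟩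
    simp only [Finset.mem_insert, not_or] at hj hi
    obtain rfl | hj := hj
    · exact hmax i hi.2
    · exact h j hj i hi.2

lemma GreedySet.eq_of_gap {x : X} {m : ℕ} {s : ℝ} {S D : Finset ℕ} (hS : GreedySet f x m s S)
    (hD : D.card = m) (hgap : ∀ k ∈ D, ∀ j ∉ D, ‖f j x‖ < s * ‖f k x‖) : S = D := by
  by_contra hne
  have h1 : ¬ D ⊆ S := fun h =>
    hne (Finset.eq_of_subset_of_card_le h (by rw [hS.1, hD])).symm
  have h2 : ¬ S ⊆ D := fun h =>
    hne (Finset.eq_of_subset_of_card_le h (by rw [hS.1, hD]))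
  obtain ⟨k, hk, hkS⟩ := Finset.not_subset.1 h1
  obtain ⟨j, hj, hjD⟩ := Finset.not_subset.1 h2
  exact (hgap k hk j hjD).not_ge (hS.2 j hj k hkS)

lemma wsum_mono (w : ℕ → ℝ) {S T : Set ℕ} (h : S ⊆ T) : wsum w S ≤ wsum w T :=
  ENNReal.tsum_mono_subtype (fun i => ENNReal.ofReal (w i)) h

lemma wsum_coe_finset {w : ℕ → ℝ} (hw : ∀ i, 0 < w i) (A : Finset ℕ) :
    wsum w (A : Set ℕ) = ENNReal.ofReal (∑ i ∈ A, w i) := by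
  rw [wsum, Finset.tsum_subtype' A (fun i => ENNReal.ofReal (w i)),
    ENNReal.ofReal_sum_of_nonneg fun i _ => (hw i).le]

/-- The semi-greedy inequality tested against expansions over finite sets of indices. -/
lemma SemiGreedy.exists_le_norm_sub_sum {w : ℕ → ℝ} {C s : ℝ} (hsg : SemiGreedy e f w C s)
    (hb : IsMarkushevichBasis e f) (hw : ∀ i, 0 < w i) (x : X) (m : ℕ) :
    ∃ S : Finset ℕ, GreedySet f x m s S ∧ ∃ y : X, y = ∑ j ∈ S, f j y • e j ∧
      ∀ (B : Finset ℕ) (c : ℕ → 𝕜), ∑ i ∈ B, w i ≤ ∑ i ∈ S, w i →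
        ‖x - y‖ ≤ C * ‖x - ∑ j ∈ B, c j • e j‖ := by
  obtain ⟨S, hS, y, hy, h⟩ := hsg x m
  refine ⟨S, hS, y, hb.eq_sum_of_msupp_subset hy, fun B c hB => h _ ?_ ?_⟩
  · exact B.finite_toSet.subset (hb.msupp_sum_subset B c)
  · refine (wsum_mono w (hb.msupp_sum_subset B c)).trans ?_
    rw [wsum_coe_finset hw, wsum_coe_finset hw]
    exact ENNReal.ofReal_le_ofReal hB

end Expansions

section Estimates

variable {e : ℕ → X} {f : ℕ → X →L[𝕜] 𝕜} {w : ℕ → ℝ} {C s : ℝ}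

lemma SemiGreedy.exists_norm_add_le (hsg : SemiGreedy e f w C s)
    (hb : IsMarkushevichBasis e f) (hw : ∀ i, 0 < w i) (hs : 0 < s)
    {E D : Finset ℕ} (hED : Disjoint E D) (hwED : ∑ i ∈ E, w i ≤ ∑ i ∈ D, w i)
    {c : ℕ → 𝕜} (hc : ∀ i ∈ E, ‖c i‖ ≤ 1) :
    ∃ a : ℕ → 𝕜, ‖∑ j ∈ E, c j • e j + ∑ j ∈ D, a j • e j‖ ≤
      C * (2 / s * ‖∑ j ∈ D, e j‖) := by
  set R : 𝕜 := ((2 / s : ℝ) : 𝕜) with hR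
  have hRn : ‖R‖ = 2 / s := by
    rw [hR, RCLike.norm_ofReal, abs_of_pos (by positivity)]
  set x : X := ∑ j ∈ E, c j • e j + ∑ j ∈ D, R • e j with hx
  have hcoef : ∀ i, f i x = (if i ∈ E then c i else 0) + if i ∈ D then R else 0 := fun i => by
    rw [hx, map_add, hb.coeff_sum, hb.coeff_sum D (fun _ => R)]
  obtain ⟨S, hS, y, hy, h⟩ := hsg.exists_le_norm_sub_sum hb hw x D.card
  obtain rfl : S = D := by
    refine hS.eq_of_gap rfl fun k hk j hj => ?_
    have h1 : ‖f k x‖ = 2 / s := by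
      rw [hcoef, if_pos hk, if_neg (Finset.disjoint_right.1 hED hk), zero_add, hRn]
    have h2 : ‖f j x‖ ≤ 1 := by
      rw [hcoef, if_neg hj, add_zero]
      split_ifs with hjE
      · exact hc j hjE
      · simp
    rw [h1, mul_div_cancel₀ _ hs.ne']
    linarith
  refine ⟨fun j => R - f j y, ?_⟩
  have h1 : ∑ j ∈ E, c j • e j + ∑ j ∈ S, (R - f j y) • e j = x - y := by
    simp only [sub_smul, Finset.sum_sub_distrib]
    rw [← hy, hx]
    abel
  have h2 : x - ∑ j ∈ E, c j • e j = R • ∑ j ∈ S, e j := by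
    rw [hx, add_sub_cancel_left, Finset.smul_sum]
  have h3 := h E c hwED
  rwa [h2, norm_smul, hRn, ← h1] at h3

lemma norm_sum_erase_le {A : Finset ℕ} {c : ℕ → 𝕜} {M : ℝ} (hM0 : 0 ≤ M)
    (hM : ∀ i, ‖e i‖ ≤ M) (hc : ∀ i ∈ A, ‖c i‖ ≤ 1) (i : ℕ) :
    ‖∑ j ∈ A, c j • e j‖ ≤ ‖∑ j ∈ A.erase i, c j • e j‖ + M := by
  by_cases hi : i ∈ A
  · rw [← Finset.sum_erase_add A _ hi]
    refine (norm_add_le _ _).trans (add_le_add le_rfl ?_)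
    rw [norm_smul]
    exact (mul_le_of_le_one_left (norm_nonneg _) (hc i hi)).trans (hM i)
  · rw [Finset.erase_eq_of_notMem hi]
    linarith

lemma SemiGreedy.exists_bound_of_le_single (hsg : SemiGreedy e f w C s)
    (hb : IsMarkushevichBasis e f) (hw : ∀ i, 0 < w i) (hC : 0 < C) (hs : 0 < s) :
    ∃ K : ℝ, 0 < K ∧ ∀ (i : ℕ) (E : Finset ℕ) (c : ℕ → 𝕜), (∀ j ∈ E, ‖c j‖ ≤ 1) →
      ∑ j ∈ E, w j ≤ w i → ‖∑ j ∈ E, c j • e j‖ ≤ K := by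
  obtain ⟨M, hM1, hMe, hMf⟩ := hb.exists_bound
  have hM0 : 0 < M := by linarith
  set Q : ℝ := C * (2 / s * M) with hQ
  have hQ0 : 0 < Q := by positivity
  refine ⟨Q + M * Q * M + M, by positivity, fun i E c hc hE => ?_⟩
  refine (norm_sum_erase_le hM0.le hMe hc i).trans (add_le_add ?_ le_rfl)
  have hE' : ∑ j ∈ E.erase i, w j ≤ ∑ j ∈ {i}, w j := by
    rw [Finset.sum_singleton]
    exact (Finset.sum_le_sum_of_subset_of_nonneg (Finset.erase_subset _ _)
      fun j _ _ => (hw j).le).trans hE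
  obtain ⟨a, ha⟩ := hsg.exists_norm_add_le hb hw hs (E := E.erase i) (D := {i})
    (by simp) hE' (c := c) fun j hj => hc j (Finset.mem_of_mem_erase hj)
  simp only [Finset.sum_singleton] at ha
  set v := ∑ j ∈ E.erase i, c j • e j with hv
  have h1 : ‖v + a i • e i‖ ≤ Q :=
    ha.trans (by rw [hQ]; gcongr; exact hMe i)
  have h2 : f i (v + a i • e i) = a i := by
    rw [map_add, hv, hb.coeff_sum]
    simp [hb.biorth]
  have h3 : ‖a i‖ ≤ M * Q := by
    rw [← h2]
    exact (hMf i _).trans (by gcongr)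
  calc ‖v‖ = ‖(v + a i • e i) - a i • e i‖ := by rw [add_sub_cancel_right]
    _ ≤ ‖v + a i • e i‖ + ‖a i • e i‖ := norm_sub_le _ _
    _ ≤ Q + M * Q * M := by
      rw [norm_smul]
      gcongr
      exact hMe i

lemma SemiGreedy.exists_bound_one_add_sum (hsg : SemiGreedy e f w C s)
    (hb : IsMarkushevichBasis e f) (hw : ∀ i, 0 < w i) (hC : 0 < C) (hs : 0 < s) :
    ∃ K : ℝ, 0 < K ∧ ∀ (E : Finset ℕ) (c : ℕ → 𝕜), (∀ j ∈ E, ‖c j‖ ≤ 1) →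
      ‖∑ j ∈ E, c j • e j‖ ≤ K * (1 + ∑ j ∈ E, w j) := by
  obtain ⟨M, hM1, hMe, -⟩ := hb.exists_bound
  have hM0 : 0 < M := by linarith
  obtain ⟨K, hK, h⟩ := hsg.exists_bound_of_le_single hb hw hC hs
  have hw0 := hw 0
  refine ⟨(K + M) + (K + M) / w 0, by positivity, fun E c hc => ?_⟩
  induction E using Finset.strongInduction with
  | H E ih =>
    have hEnn : 0 ≤ ∑ j ∈ E, w j := Finset.sum_nonneg fun j _ => (hw j).le
    by_cases hE : ∑ j ∈ E, w j ≤ w 0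
    · calc ‖∑ j ∈ E, c j • e j‖ ≤ K := h 0 E c hc hE
        _ ≤ ((K + M) + (K + M) / w 0) * 1 := by
          have : 0 ≤ (K + M) / w 0 := by positivity
          linarith
        _ ≤ _ := by gcongr; linarith
    · obtain ⟨P, hP, hmax⟩ := Finset.exists_max_image
        (E.powerset.filter fun P => ∑ j ∈ P, w j ≤ w 0) Finset.card ⟨∅, by simp [hw0.le]⟩
      simp only [Finset.mem_filter, Finset.mem_powerset] at hP hmax
      obtain ⟨j, hjE, hjP⟩ : ∃ j ∈ E, j ∉ P := by
        by_contra! hcon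
        exact hE (by rw [← hP.1.antisymm hcon]; exact hP.2)
      have hPj : insert j P ⊆ E := Finset.insert_subset hjE hP.1
      have hlt : w 0 < ∑ i ∈ insert j P, w i := by
        by_contra! hcon
        have := hmax _ ⟨hPj, hcon⟩
        rw [Finset.card_insert_of_notMem hjP] at this
        omega
      have h1 := ih (E \ insert j P)
        (Finset.sdiff_ssubset hPj (Finset.insert_nonempty _ _))
        fun i hi => hc i (Finset.sdiff_subset hi)
      have h2 : ‖∑ i ∈ insert j P, c i • e i‖ ≤ K + M := by
        refine (norm_sum_erase_le hM0.le hMe (fun i hi => hc i (hPj hi)) j).trans ?_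
        rw [Finset.erase_insert hjP]
        exact add_le_add (h 0 P c (fun i hi => hc i (hP.1 hi)) hP.2) le_rfl
      have h3 := Finset.sum_sdiff (f := w) hPj
      have h4 := Finset.sum_sdiff (f := fun i => c i • e i) hPj
      have h5 : K + M ≤ ((K + M) + (K + M) / w 0) * ∑ i ∈ insert j P, w i := by
        calc K + M ≤ ((K + M) + (K + M) / w 0) * w 0 := by
              rw [add_mul, div_mul_cancel₀ _ hw0.ne']
              have : 0 ≤ (K + M) * w 0 := by positivity
              linarith
          _ ≤ _ := by gcongr
      rw [← h4, ← h3]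
      refine (norm_add_le _ _).trans ?_
      nlinarith

/-- Adding small coefficients on a set `D` that is far out and no heavier than a set where `u`
has coefficients of modulus at least one does not change the norm much, up to
a correction supported on the large coefficients of `u`. -/
lemma SemiGreedy.exists_correction (hsg : SemiGreedy e f w C s)
    (hb : IsMarkushevichBasis e f) (hw : ∀ i, 0 < w i) (hs : 0 < s) (hs1 : s ≤ 1)
    (u : X) {A : Finset ℕ} (hA : ∀ i ∈ A, 1 ≤ ‖f i u‖) :
    ∃ (T : Finset ℕ) (N : ℕ), ∀ (D : Finset ℕ) (c : ℕ → 𝕜), (∀ i ∈ D, N ≤ i) →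
      (∀ i ∈ D, ‖c i‖ ≤ 1) → ∑ i ∈ D, w i ≤ ∑ i ∈ A, w i →
      ∃ y : X, y = ∑ j ∈ T, f j y • e j ∧
        ‖u - y + ((s ^ 2 / 4 : ℝ) : 𝕜) • ∑ j ∈ D, c j • e j‖ ≤ C * ‖u‖ := by
  have hs2 : 0 < s ^ 2 := by positivity
  set T := (hb.finite_le_coeff u hs2).toFinset with hT
  set G := (hb.finite_le_coeff u hs).toFinset with hG
  have hev : ∀ᶠ i in atTop, ‖f i u‖ < s ^ 2 / 4 := by
    rw [← Nat.cofinite_eq_atTop]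
    exact (hb.tendsto_coeff u).eventually_lt_const (by positivity)
  obtain ⟨N, hN⟩ := eventually_atTop.1 hev
  refine ⟨T, N, fun D c hDN hc hwD => ?_⟩
  set r : 𝕜 := ((s ^ 2 / 4 : ℝ) : 𝕜) with hr
  have hrn : ‖r‖ = s ^ 2 / 4 := by
    rw [hr, RCLike.norm_ofReal, abs_of_pos (by positivity)]
  set x := u + ∑ j ∈ D, (r * c j) • e j with hx
  have hxD : ∀ i ∉ D, f i x = f i u := fun i hi => by
    rw [hx, map_add, hb.coeff_sum, if_neg hi, add_zero]
  have hxD' : ∀ i ∈ D, ‖f i x‖ < s ^ 2 := fun i hi => by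
    rw [hx, map_add, hb.coeff_sum, if_pos hi]
    refine (norm_add_le _ _).trans_lt ?_
    rw [norm_mul, hrn]
    have h1 := hN i (hDN i hi)
    have h2 := hc i hi
    nlinarith
  have hss : s ^ 2 ≤ s := by nlinarith
  have hGD : ∀ i ∈ G, i ∉ D := fun i hi hiD => by
    have h1 : s ≤ ‖f i u‖ := by simpa [hG] using hi
    have := hN i (hDN i hiD)
    linarith
  have hAG : A ⊆ G := fun i hi => by
    simpa [hG] using hs1.trans (hA i hi)
  obtain ⟨S, hS, y, hy, h⟩ := hsg.exists_le_norm_sub_sum hb hw x G.card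
  have hAST : A ⊆ S ∧ S ⊆ T := by
    by_cases hSG : S = G
    · subst hSG
      refine ⟨hAG, fun i hi => ?_⟩
      have h1 : s ≤ ‖f i u‖ := by simpa [hG] using hi
      simpa [hT] using hss.trans h1
    · obtain ⟨k, hk, hkS⟩ := Finset.not_subset.1 fun h' : G ⊆ S =>
        hSG (Finset.eq_of_subset_of_card_le h' hS.1.le).symm
      obtain ⟨j, hj, hjG⟩ := Finset.not_subset.1 fun h' : S ⊆ G =>
        hSG (Finset.eq_of_subset_of_card_le h' hS.1.ge)
      have hbig : ∀ i ∈ S, i ∉ D ∧ s ^ 2 ≤ ‖f i u‖ := by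
        intro i hi
        have h1 := hS.2 i hi k hkS
        have h2 : s ≤ ‖f k x‖ := by
          rw [hxD k (hGD k hk)]
          simpa [hG] using hk
        have h3 : s ^ 2 ≤ ‖f i x‖ := by nlinarith
        have h4 : i ∉ D := fun hiD => (hxD' i hiD).not_ge h3
        exact ⟨h4, by rwa [hxD i h4] at h3⟩
      refine ⟨fun i hi => ?_, fun i hi => by simpa [hT] using (hbig i hi).2⟩
      by_contra hiS
      have h1 := hS.2 j hj i hiS
      rw [hxD i (hGD i (hAG hi)), hxD j (hbig j hj).1] at h1
      have h2 := hA i hi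
      apply hjG
      simp only [hG, Set.Finite.mem_toFinset, Set.mem_ofPred_eq]
      nlinarith
  have hsum : ∑ j ∈ D, (r * c j) • e j = r • ∑ j ∈ D, c j • e j := by
    simp only [mul_smul, Finset.smul_sum]
  refine ⟨y, ?_, ?_⟩
  · refine hb.eq_sum_of_msupp_subset fun i hi => hAST.2 ?_
    rw [hy] at hi
    exact hb.msupp_sum_subset _ _ hi
  · have h1 := h D (fun j => r * c j) (hwD.trans
      (Finset.sum_le_sum_of_subset_of_nonneg hAST.1 fun i _ _ => (hw i).le))
    rw [hx, add_sub_cancel_right, hsum] at h1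
    rwa [sub_add_eq_add_sub]

end Estimates

section Bidual

open NormedSpace

lemma exists_tendsto_hyperfilter_of_norm_le {V : ℕ → X} {K : ℝ} (hV : ∀ n, ‖V n‖ ≤ K) :
    ∃ L : StrongDual 𝕜 (StrongDual 𝕜 X), ∀ ψ : StrongDual 𝕜 X,
      Tendsto (fun n => ψ (V n)) (hyperfilter ℕ : Filter ℕ) (nhds (L ψ)) := by
  let g : ℕ → WeakDual 𝕜 (StrongDual 𝕜 X) := fun n =>
    StrongDual.toWeakDual (inclusionInDoubleDual 𝕜 X (V n))
  have hg : ∀ n, g n ∈ WeakDual.toStrongDual ⁻¹'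
      Metric.closedBall (0 : StrongDual 𝕜 (StrongDual 𝕜 X)) K := fun n => by
    have : ‖inclusionInDoubleDual 𝕜 X (V n)‖ ≤ K := (double_dual_bound 𝕜 X (V n)).trans (hV n)
    exact (mem_closedBall_zero_iff (E := StrongDual 𝕜 (StrongDual 𝕜 X))).2 this
  obtain ⟨L, -, hL⟩ := (WeakDual.isCompact_closedBall
    (0 : StrongDual 𝕜 (StrongDual 𝕜 X)) K).ultrafilter_le_nhds
    (Ultrafilter.map g (hyperfilter ℕ))
    (by
      rw [le_principal_iff]
      exact Filter.mem_map.2 (Filter.Eventually.of_forall hg))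
  refine ⟨WeakDual.toStrongDual L, fun ψ => ?_⟩
  exact ((WeakDual.eval_continuous ψ).tendsto L).comp hL

lemma exists_mem_ker_of_le_dist {Y : Type*} [NormedAddCommGroup Y] [NormedSpace 𝕜 Y]
    {L : StrongDual 𝕜 Y} {ι : Type*} [Fintype ι] {G : ι → StrongDual 𝕜 Y} {d : ℝ} (hd : 0 < d)
    (hL : ∀ a : ι → 𝕜, d ≤ ‖L - ∑ i, a i • G i‖) :
    ∃ ψ : Y, ‖ψ‖ ≤ 1 ∧ (∀ i, G i ψ = 0) ∧ d / 2 ≤ RCLike.re (L ψ) := by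
  by_contra! hcon
  let p : Submodule 𝕜 Y := ⨅ i, LinearMap.ker (G i).toLinearMap
  have hp : ∀ ψ, ψ ∈ p ↔ ∀ i, G i ψ = 0 := fun ψ => by
    simp [p, Submodule.mem_iInf]
  have hle : ‖L.comp p.subtypeL‖ ≤ d / 2 := by
    refine ContinuousLinearMap.opNorm_le_bound _ (by positivity) fun ψ => ?_
    by_contra! hlt
    obtain ⟨ψ, hψ⟩ := ψ
    change d / 2 * ‖ψ‖ < ‖L ψ‖ at hlt
    have hLpos : 0 < ‖L ψ‖ := lt_of_le_of_lt (by positivity) hlt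
    have hψpos : 0 < ‖ψ‖ := by
      rw [norm_pos_iff]
      rintro rfl
      simp at hLpos
    let a : 𝕜 := (starRingEnd 𝕜) (L ψ) * (((‖L ψ‖ * ‖ψ‖)⁻¹ : ℝ) : 𝕜)
    have ha : ‖a‖ = ‖ψ‖⁻¹ := by
      simp only [a, norm_mul, RCLike.norm_conj, RCLike.norm_ofReal]
      rw [abs_of_pos (by positivity)]
      field_simp
    have h1 := hcon (a • ψ) (by rw [norm_smul, ha, inv_mul_cancel₀ hψpos.ne'])
      fun i => by rw [map_smul, (hp ψ).1 hψ i, smul_zero]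
    have h2 : L (a • ψ) = ((‖L ψ‖ * ‖ψ‖⁻¹ : ℝ) : 𝕜) := by
      rw [map_smul, smul_eq_mul]
      simp only [a]
      rw [mul_right_comm, RCLike.conj_mul]
      norm_cast
      field_simp
    rw [h2, RCLike.ofReal_re, ← div_eq_mul_inv, div_lt_iff₀ hψpos] at h1
    linarith
  obtain ⟨L', hL', hnorm⟩ := exists_extension_norm_eq p (L.comp p.subtypeL)
  have hmem : (L - L').toLinearMap ∈ Submodule.span 𝕜
      (Set.range fun i => (G i).toLinearMap) := by
    refine mem_span_of_iInf_ker_le_ker fun ψ hψ => ?_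
    have : L' ψ = L ψ := hL' ⟨ψ, hψ⟩
    simp [this]
  obtain ⟨a, ha⟩ := (Submodule.mem_span_range_iff_exists_fun 𝕜).1 hmem
  have heq : L - ∑ i, a i • G i = L' := by
    ext ψ
    have := congrArg (fun g => g ψ) ha
    simp only [LinearMap.coe_sum, Finset.sum_apply, LinearMap.smul_apply,
      ContinuousLinearMap.coe_coe, _root_.sub_apply, smul_eq_mul] at this
    simp [this]
  have h1 := hL a
  rw [heq, hnorm] at h1
  linarith

lemma exists_annihilator_of_le_dist {L : StrongDual 𝕜 (StrongDual 𝕜 X)} {d : ℝ} (hd : 0 < d)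
    (hL : ∀ v, d ≤ ‖L - inclusionInDoubleDual 𝕜 X v‖) {ι : Type*} [Fintype ι] (v : ι → X) :
    ∃ ψ : StrongDual 𝕜 X, ‖ψ‖ ≤ 1 ∧ (∀ i, ψ (v i) = 0) ∧ d / 2 ≤ RCLike.re (L ψ) :=
  exists_mem_ker_of_le_dist (G := fun i => inclusionInDoubleDual 𝕜 X (v i)) hd fun a => by
    simpa only [map_sum, map_smul] using hL (∑ i, a i • v i)

end Bidual

section Quasi

variable {e : ℕ → X} {f : ℕ → X →L[𝕜] 𝕜} {w : ℕ → ℝ} {C s : ℝ}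

open NormedSpace

lemma exists_far_sum_re_ge {ψ : StrongDual 𝕜 X} {b d : ℝ}
    (h : ∀ N : ℕ, ∃ (E : Finset ℕ) (c : ℕ → 𝕜), (∀ j ∈ E, N ≤ j) ∧ (∀ j ∈ E, ‖c j‖ ≤ 1) ∧
      ∑ j ∈ E, w j ≤ b ∧ d ≤ RCLike.re (ψ (∑ j ∈ E, c j • e j))) (N n : ℕ) :
    ∃ (E : Finset ℕ) (c : ℕ → 𝕜), (∀ j ∈ E, N ≤ j) ∧ (∀ j ∈ E, ‖c j‖ ≤ 1) ∧
      ∑ j ∈ E, w j ≤ n * b ∧ n * d ≤ RCLike.re (ψ (∑ j ∈ E, c j • e j)) := by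
  induction n with
  | zero => exact ⟨∅, 0, by simp⟩
  | succ n ih =>
    obtain ⟨E, c, hE, hc, hw, hd⟩ := ih
    obtain ⟨E', c', hE', hc', hw', hd'⟩ := h (max N (E.sup id + 1))
    have hdisj : Disjoint E E' := by
      rw [Finset.disjoint_left]
      intro j hj hj'
      have h1 := (le_max_right _ _).trans (hE' j hj')
      have h2 : j ≤ E.sup id := Finset.le_sup (f := id) hj
      omega
    classical
    refine ⟨E ∪ E', fun j => if j ∈ E then c j else c' j, fun j hj => ?_, fun j hj => ?_, ?_, ?_⟩
    · obtain hj | hj := Finset.mem_union.1 hj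
      · exact hE j hj
      · exact (le_max_left _ _).trans (hE' j hj)
    · obtain hj | hj := Finset.mem_union.1 hj
      · simpa [hj] using hc j hj
      · simpa [Finset.disjoint_right.1 hdisj hj] using hc' j hj
    · rw [Finset.sum_union hdisj]
      push_cast
      linarith
    · have h1 : ∑ j ∈ E, (if j ∈ E then c j else c' j) • e j = ∑ j ∈ E, c j • e j :=
        Finset.sum_congr rfl fun j hj => by rw [if_pos hj]
      have h2 : ∑ j ∈ E', (if j ∈ E then c j else c' j) • e j = ∑ j ∈ E', c' j • e j :=
        Finset.sum_congr rfl fun j hj => by rw [if_neg (Finset.disjoint_right.1 hdisj hj)]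
      rw [Finset.sum_union hdisj, h1, h2, map_add, map_add]
      push_cast
      linarith

lemma one_le_mul_norm_of_one_le_coeff {M : ℝ} (hM : ∀ i x, ‖f i x‖ ≤ M * ‖x‖)
    {A : Finset ℕ} (hA : A.Nonempty) {u : X} (hu : ∀ i ∈ A, 1 ≤ ‖f i u‖) : 1 ≤ M * ‖u‖ := by
  obtain ⟨i, hi⟩ := hA
  exact (hu i hi).trans (hM i u)

variable [CompleteSpace X]

/-- A bounded sequence of vectors whose coefficients tend to zero but which is not weakly null
has a weak-star cluster point in the bidual at positive distance from the space. -/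
lemma IsMarkushevichBasis.exists_cluster_le_dist (hb : IsMarkushevichBasis e f) {V : ℕ → X}
    {K δ : ℝ} (hV : ∀ n, ‖V n‖ ≤ K) (hf : ∀ i, ∀ᶠ n in atTop, f i (V n) = 0)
    {φ : StrongDual 𝕜 X} (hδ : 0 < δ) (hφ : ∀ n, δ ≤ ‖φ (V n)‖) :
    ∃ (L : StrongDual 𝕜 (StrongDual 𝕜 X)) (d : ℝ), 0 < d ∧
      (∀ ψ : StrongDual 𝕜 X,
        Tendsto (fun n => ψ (V n)) (hyperfilter ℕ : Filter ℕ) (nhds (L ψ))) ∧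
      ∀ v, d ≤ ‖L - inclusionInDoubleDual 𝕜 X v‖ := by
  obtain ⟨L, hL⟩ := exists_tendsto_hyperfilter_of_norm_le (𝕜 := 𝕜) hV
  have hLf : ∀ i, L (f i) = 0 := fun i => by
    refine tendsto_nhds_unique (hL (f i)) (tendsto_const_nhds.congr' ?_)
    filter_upwards [Nat.hyperfilter_le_atTop (hf i)] with n hn
    exact hn.symm
  have hLφ : δ ≤ ‖L φ‖ := ge_of_tendsto' (hL φ).norm hφ
  have hrange : IsClosed (Set.range (inclusionInDoubleDualLi (E := X) 𝕜)) :=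
    (inclusionInDoubleDualLi (E := X) 𝕜).isometry.isUniformInducing.isComplete_range.isClosed
  have hnot : L ∉ Set.range (inclusionInDoubleDualLi (E := X) 𝕜) := by
    rintro ⟨v, hv⟩
    have hv' : ∀ ψ : StrongDual 𝕜 X, L ψ = ψ v := fun ψ => by rw [← hv]; rfl
    have h0 : v = 0 := hb.total v fun i => by rw [← hv', hLf]
    rw [hv', h0, map_zero, norm_zero] at hLφ
    linarith
  refine ⟨L, Metric.infDist L (Set.range (inclusionInDoubleDualLi (E := X) 𝕜)),
    (hrange.notMem_iff_infDist_pos (Set.range_nonempty _)).1 hnot, hL, fun v => ?_⟩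
  have hv : inclusionInDoubleDual 𝕜 X v ∈ Set.range (inclusionInDoubleDualLi (E := X) 𝕜) :=
    ⟨v, rfl⟩
  exact (Metric.infDist_le_dist_of_mem hv).trans_eq
    (dist_eq_norm (E := StrongDual 𝕜 (StrongDual 𝕜 X)) _ _)

lemma SemiGreedy.exists_bound_of_not_weaklyNull (hsg : SemiGreedy e f w C s)
    (hb : IsMarkushevichBasis e f) (hw : ∀ i, 0 < w i) (hC : 0 < C) (hs : 0 < s) (hs1 : s ≤ 1)
    {φ : StrongDual 𝕜 X} {b δ : ℝ} (hδ : 0 < δ)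
    (hφ : ∀ N : ℕ, ∃ E : Finset ℕ, (∀ j ∈ E, N ≤ j) ∧ ∑ j ∈ E, w j ≤ b ∧
      δ ≤ ∑ j ∈ E, ‖φ (e j)‖) :
    ∃ K : ℝ, 0 < K ∧ ∀ (u : X) (A : Finset ℕ) (c : ℕ → 𝕜), A.Nonempty →
      (∀ i ∈ A, 1 ≤ ‖f i u‖) → (∀ i ∈ A, ‖c i‖ ≤ 1) → ‖∑ j ∈ A, c j • e j‖ ≤ K * ‖u‖ := by
  obtain ⟨M, hM1, hMe, hMf⟩ := hb.exists_bound
  have hM0 : 0 < M := by linarith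
  obtain ⟨K, hK, hKb⟩ := hsg.exists_bound_one_add_sum hb hw hC hs
  have hb0 : 0 < b := by
    obtain ⟨E, -, h1, h2⟩ := hφ 0
    have : E.Nonempty := by
      rw [Finset.nonempty_iff_ne_empty]
      rintro rfl
      simp at h2
      linarith
    exact (Finset.sum_pos (fun j _ => hw j) this).trans_le h1
  choose E hEN hEw hEφ using hφ
  let σ : ℕ → 𝕜 := fun j => (starRingEnd 𝕜) (φ (e j)) * ((‖φ (e j)‖⁻¹ : ℝ) : 𝕜)
  have hσ : ∀ j, ‖σ j‖ ≤ 1 := fun j => by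
    simp only [σ, norm_mul, RCLike.norm_conj, RCLike.norm_ofReal, abs_inv, abs_norm]
    exact mul_inv_le_one
  have hσφ : ∀ j, σ j * φ (e j) = (‖φ (e j)‖ : 𝕜) := fun j => by
    simp only [σ]
    rw [mul_right_comm, RCLike.conj_mul]
    norm_cast
    by_cases h : ‖φ (e j)‖ = 0
    · simp [h]
    · field_simp
  let V : ℕ → X := fun n => ∑ j ∈ E n, σ j • e j
  have hV : ∀ n, ‖V n‖ ≤ K * (1 + b) := fun n =>
    (hKb (E n) σ fun j _ => hσ j).trans (by gcongr; exact hEw n)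
  have hVf : ∀ i, ∀ᶠ n in atTop, f i (V n) = 0 := fun i => by
    filter_upwards [eventually_gt_atTop i] with n hn
    rw [hb.coeff_sum, if_neg fun hi => (hEN n i hi).not_gt hn]
  have hVφ : ∀ n, δ ≤ ‖φ (V n)‖ := fun n => by
    have : φ (V n) = ((∑ j ∈ E n, ‖φ (e j)‖ : ℝ) : 𝕜) := by
      simp only [V, map_sum, map_smul, smul_eq_mul, hσφ]
    rw [this, RCLike.norm_ofReal]
    exact (hEφ n).trans (le_abs_self _)
  obtain ⟨L, d, hd, hL, hLd⟩ := hb.exists_cluster_le_dist hV hVf hδ hVφ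
  have hs2 : 0 < s ^ 2 / 4 := by positivity
  refine ⟨K * ((1 + b) * M + b * (C / (s ^ 2 / 4 * (d / 4)))), by positivity,
    fun u A c hAne hA hc => ?_⟩
  obtain ⟨T, N, hTN⟩ := hsg.exists_correction hb hw hs hs1 u hA
  obtain ⟨ψ, hψ1, hψ0, hψL⟩ := exists_annihilator_of_le_dist hd hLd
    (fun i : Option T => i.elim u fun j => e j)
  have hψu : ψ u = 0 := hψ0 none
  have hψT : ∀ j ∈ T, ψ (e j) = 0 := fun j hj => hψ0 (some ⟨j, hj⟩)
  have hev : ∀ᶠ n in (hyperfilter ℕ : Filter ℕ), d / 4 < RCLike.re (ψ (V n)) :=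
    ((RCLike.continuous_re.tendsto _).comp (hL ψ)).eventually_const_lt (by linarith)
  have hfar : ∀ N : ℕ, ∃ (E : Finset ℕ) (c : ℕ → 𝕜), (∀ j ∈ E, N ≤ j) ∧ (∀ j ∈ E, ‖c j‖ ≤ 1) ∧
      ∑ j ∈ E, w j ≤ b ∧ d / 4 ≤ RCLike.re (ψ (∑ j ∈ E, c j • e j)) := by
    intro N
    obtain ⟨n, hn, hnN⟩ := (hev.and (Nat.hyperfilter_le_atTop (eventually_ge_atTop N))).exists
    exact ⟨E n, σ, fun j hj => hnN.trans (hEN n j hj), fun j _ => hσ j, hEw n, hn.le⟩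
  have hWA : 0 ≤ ∑ i ∈ A, w i := Finset.sum_nonneg fun i _ => (hw i).le
  set n := ⌊(∑ i ∈ A, w i) / b⌋₊ with hn
  have hn1 : n * b ≤ ∑ i ∈ A, w i := by
    rw [← le_div_iff₀ hb0]
    exact Nat.floor_le (by positivity)
  have hn2 : ∑ i ∈ A, w i ≤ (n + 1) * b := by
    rw [← div_le_iff₀ hb0]
    exact (Nat.lt_floor_add_one _).le
  obtain ⟨D, c', hDN, hc', hDw, hDψ⟩ := exists_far_sum_re_ge hfar N n
  obtain ⟨y, hy, hbound⟩ := hTN D c' hDN hc' (hDw.trans hn1)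
  have hψy : ψ y = 0 := by
    rw [hy, map_sum]
    exact Finset.sum_eq_zero fun j hj => by rw [map_smul, hψT j hj, smul_zero]
  have hlow : s ^ 2 / 4 * (n * (d / 4)) ≤ C * ‖u‖ := by
    refine le_trans ?_ (((ψ.le_of_opNorm_le hψ1 _).trans (one_mul _).le).trans hbound)
    rw [map_add, map_sub, hψu, hψy, sub_zero, zero_add, map_smul, smul_eq_mul, norm_mul,
      RCLike.norm_ofReal, abs_of_pos hs2]
    gcongr
    exact hDψ.trans (RCLike.re_le_norm _)
  have hnu : (n : ℝ) ≤ C / (s ^ 2 / 4 * (d / 4)) * ‖u‖ := by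
    rw [div_mul_eq_mul_div, le_div_iff₀ (by positivity)]
    linarith
  have hu := one_le_mul_norm_of_one_le_coeff hMf hAne hA
  calc ‖∑ j ∈ A, c j • e j‖ ≤ K * (1 + ∑ j ∈ A, w j) := hKb A c hc
    _ ≤ K * ((1 + b) * (M * ‖u‖) + b * (C / (s ^ 2 / 4 * (d / 4)) * ‖u‖)) := by
      refine mul_le_mul_of_nonneg_left ?_ hK.le
      nlinarith
    _ = _ := by ring

end Quasi

section WeaklyNull

variable {e : ℕ → X} {f : ℕ → X →L[𝕜] 𝕜} {w : ℕ → ℝ} {C s : ℝ}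

lemma exists_Ico_sum_le_lt (hw : ∀ i, 0 < w i) (hsum : ¬ Summable w) {b : ℝ} (hb : 0 ≤ b)
    (N : ℕ) : ∃ p, N ≤ p ∧ ∑ j ∈ Finset.Ico N p, w j ≤ b ∧
      b < ∑ j ∈ insert p (Finset.Ico N p), w j := by
  classical
  have hex : ∃ n, b < ∑ j ∈ Finset.Ico N n, w j := by
    have h := (not_summable_iff_tendsto_nat_atTop_of_nonneg fun i => (hw i).le).1 hsum
    obtain ⟨n, hn, hNn⟩ := ((h.eventually_gt_atTop (b + ∑ j ∈ Finset.range N, w j)).and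
      (eventually_ge_atTop N)).exists
    refine ⟨n, ?_⟩
    rw [Finset.sum_Ico_eq_sub _ hNn]
    linarith
  have hspec := Nat.find_spec hex
  have hlt : N < Nat.find hex := by
    by_contra! h
    rw [Finset.Ico_eq_empty_of_le h, Finset.sum_empty] at hspec
    linarith
  obtain ⟨p, hp⟩ := Nat.exists_eq_succ_of_ne_zero (Nat.ne_zero_of_lt hlt)
  have hNp : N ≤ p := by omega
  refine ⟨p, hNp, not_lt.1 (Nat.find_min hex (by omega)), ?_⟩
  rwa [hp, Nat.succ_eq_add_one, ← Finset.insert_Ico_right_eq_Ico_add_one hNp] at hspec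

/-- Far intervals of prescribed weight have indicator sums controlled by any vector which is
large on a set of that weight. -/
lemma SemiGreedy.exists_far_Ico_norm_le (hsg : SemiGreedy e f w C s)
    (hb : IsMarkushevichBasis e f) (hw : ∀ i, 0 < w i) (hC : 0 < C) (hs : 0 < s) (hs1 : s ≤ 1)
    (hsum : ¬ Summable w)
    (hnull : ∀ (φ : StrongDual 𝕜 X) (b δ : ℝ), 0 < δ → ∃ N : ℕ, ∀ E : Finset ℕ,
      (∀ j ∈ E, N ≤ j) → ∑ j ∈ E, w j ≤ b → ∑ j ∈ E, ‖φ (e j)‖ < δ)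
    {u : X} (hu : u ≠ 0) {A : Finset ℕ} (hA : ∀ i ∈ A, 1 ≤ ‖f i u‖) (N₁ : ℕ) :
    ∃ N p, N₁ ≤ N ∧ N ≤ p ∧ ∑ j ∈ Finset.Ico N p, w j ≤ ∑ j ∈ A, w j ∧
      ∑ j ∈ A, w j < ∑ j ∈ insert p (Finset.Ico N p), w j ∧
      s ^ 2 / 4 * ‖∑ j ∈ Finset.Ico N p, e j‖ ≤ (2 * C + 1) * ‖u‖ := by
  have hs2 : 0 < s ^ 2 / 4 := by positivity
  obtain ⟨K, hK, hKb⟩ := hsg.exists_bound_one_add_sum hb hw hC hs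
  have hWA : 0 ≤ ∑ i ∈ A, w i := Finset.sum_nonneg fun i _ => (hw i).le
  obtain ⟨T, N₀, hTN⟩ := hsg.exists_correction hb hw hs hs1 u hA
  choose p hNp hpw hwp using fun n => exists_Ico_sum_le_lt hw hsum hWA (max N₀ n)
  have hD : ∀ n, ∀ j ∈ Finset.Ico (max N₀ n) (p n), N₀ ≤ j ∧ n ≤ j := fun n j hj =>
    max_le_iff.1 (Finset.mem_Ico.1 hj).1
  choose y hy hyb using fun n => hTN (Finset.Ico (max N₀ n) (p n)) (fun _ => 1)
    (fun j hj => (hD n j hj).1) (by simp) (hpw n)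
  simp only [one_smul] at hyb
  set V : ℕ → X := fun n => ∑ j ∈ Finset.Ico (max N₀ n) (p n), e j with hV
  set r : 𝕜 := ((s ^ 2 / 4 : ℝ) : 𝕜) with hr
  have hrn : ‖r‖ = s ^ 2 / 4 := by rw [hr, RCLike.norm_ofReal, abs_of_pos hs2]
  have hVb : ∀ n, ‖V n‖ ≤ K * (1 + ∑ j ∈ A, w j) := fun n => by
    have h := hKb (Finset.Ico (max N₀ n) (p n)) (fun _ => (1 : 𝕜)) (by simp)
    simp only [one_smul] at h
    exact h.trans (mul_le_mul_of_nonneg_left (by linarith [hpw n]) hK.le)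
  have hyn : ∀ n, ‖y n‖ ≤ ‖u‖ + s ^ 2 / 4 * (K * (1 + ∑ j ∈ A, w j)) + C * ‖u‖ := fun n => by
    have h : y n = u + r • V n - (u - y n + r • V n) := by abel
    rw [h]
    refine (norm_sub_le _ _).trans (add_le_add ((norm_add_le _ _).trans ?_) (hyb n))
    rw [norm_smul, hrn]
    gcongr
    exact hVb n
  obtain ⟨L, hL⟩ := exists_tendsto_hyperfilter_of_norm_le (𝕜 := 𝕜) hyn
  set z : X := ∑ j ∈ T, L (f j) • e j with hz
  have hyz : Tendsto y (hyperfilter ℕ : Filter ℕ) (nhds z) := by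
    have h : Tendsto (fun n => ∑ j ∈ T, f j (y n) • e j) (hyperfilter ℕ : Filter ℕ) (nhds z) :=
      tendsto_finsetSum _ fun j _ => (hL (f j)).smul_const (e j)
    exact h.congr fun n => (hy n).symm
  have huz : ‖u - z‖ ≤ C * ‖u‖ := by
    obtain ⟨φ, hφ1, hφ⟩ := exists_dual_vector'' 𝕜 (u - z)
    have hφV : Tendsto (fun n => φ (V n)) (hyperfilter ℕ : Filter ℕ) (nhds 0) := by
      refine Tendsto.mono_left ?_ Nat.hyperfilter_le_atTop
      rw [Metric.tendsto_atTop]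
      intro ε hε
      obtain ⟨N, hN⟩ := hnull φ (∑ j ∈ A, w j) ε hε
      refine ⟨N, fun n hn => ?_⟩
      rw [dist_zero_right, hV, map_sum]
      exact (norm_sum_le _ _).trans_lt
        (hN _ (fun j hj => le_trans hn (hD n j hj).2) (hpw n))
    have hlim : Tendsto (fun n => ‖φ (u - y n + r • V n)‖) (hyperfilter ℕ : Filter ℕ)
        (nhds ‖φ (u - z)‖) := by
      have h := ((φ.continuous.tendsto _).comp (hyz.const_sub u)).add (hφV.const_smul r)
      rw [smul_zero, add_zero] at h
      refine (h.congr fun n => ?_).norm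
      simp
    have h := le_of_tendsto' hlim fun n =>
      ((φ.le_of_opNorm_le hφ1 _).trans (one_mul _).le).trans (hyb n)
    rwa [hφ, RCLike.norm_ofReal, abs_norm] at h
  have hupos : 0 < ‖u‖ := norm_pos_iff.2 hu
  have hev : ∀ᶠ n in (hyperfilter ℕ : Filter ℕ), ‖u - y n‖ < C * ‖u‖ + ‖u‖ :=
    (hyz.const_sub u).norm.eventually_lt_const (by linarith)
  obtain ⟨n, hn, hnN⟩ := (hev.and (Nat.hyperfilter_le_atTop (eventually_ge_atTop N₁))).exists
  refine ⟨max N₀ n, p n, le_trans hnN (le_max_right _ _), hNp n, hpw n, hwp n, ?_⟩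
  calc s ^ 2 / 4 * ‖V n‖ = ‖(u - y n + r • V n) - (u - y n)‖ := by
        rw [add_sub_cancel_left, norm_smul, hrn]
    _ ≤ C * ‖u‖ + (C * ‖u‖ + ‖u‖) := (norm_sub_le _ _).trans (add_le_add (hyb n) hn.le)
    _ = (2 * C + 1) * ‖u‖ := by ring

lemma SemiGreedy.exists_bound_of_weaklyNull (hsg : SemiGreedy e f w C s)
    (hb : IsMarkushevichBasis e f) (hw : ∀ i, 0 < w i) (hC : 0 < C) (hs : 0 < s) (hs1 : s ≤ 1)
    {W : ℝ} (hW : ∀ i, w i ≤ W) (hsum : ¬ Summable w)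
    (hnull : ∀ (φ : StrongDual 𝕜 X) (b δ : ℝ), 0 < δ → ∃ N : ℕ, ∀ E : Finset ℕ,
      (∀ j ∈ E, N ≤ j) → ∑ j ∈ E, w j ≤ b → ∑ j ∈ E, ‖φ (e j)‖ < δ) :
    ∃ K : ℝ, 0 < K ∧ ∀ (u : X) (A : Finset ℕ) (c : ℕ → 𝕜), A.Nonempty →
      (∀ i ∈ A, 1 ≤ ‖f i u‖) → (∀ i ∈ A, ‖c i‖ ≤ 1) → ‖∑ j ∈ A, c j • e j‖ ≤ K * ‖u‖ := by
  obtain ⟨M, hM1, hMe, hMf⟩ := hb.exists_bound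
  have hM0 : 0 < M := by linarith
  have hs2 : 0 < s ^ 2 / 4 := by positivity
  refine ⟨2 * (C * (2 / s * ((2 * C + 1) / (s ^ 2 / 4) + M * M))), by positivity,
    fun u A c hAne hA hc => ?_⟩
  have hu := one_le_mul_norm_of_one_le_coeff hMf hAne hA
  have hu0 : u ≠ 0 := by
    rintro rfl
    norm_num at hu
  set v := ∑ j ∈ A, c j • e j with hv
  obtain ⟨φ, hφ1, hφ⟩ := exists_dual_vector'' 𝕜 v
  obtain ⟨N₁, hN₁⟩ := hnull φ (∑ j ∈ A, w j + W) (1 / M) (by positivity)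
  obtain ⟨N, p, hN, hNp, hpw, hwp, hbound⟩ := hsg.exists_far_Ico_norm_le hb hw hC hs hs1 hsum
    hnull hu0 hA (max N₁ (A.sup id + 1))
  have hp : p ∉ Finset.Ico N p := by simp
  set D := insert p (Finset.Ico N p) with hD
  have hDN : ∀ j ∈ D, N ≤ j := fun j hj => by
    obtain rfl | hj := Finset.mem_insert.1 hj
    · exact hNp
    · exact (Finset.mem_Ico.1 hj).1
  have hAD : Disjoint A D := by
    rw [Finset.disjoint_left]
    intro j hj hj'
    have h1 := (le_max_right _ _).trans (hN.trans (hDN j hj'))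
    have h2 : j ≤ A.sup id := Finset.le_sup (f := id) hj
    omega
  obtain ⟨a, ha⟩ := hsg.exists_norm_add_le hb hw hs hAD hwp.le hc
  set Q := C * (2 / s * ‖∑ j ∈ D, e j‖) with hQ
  have hQ0 : 0 ≤ Q := by positivity
  have haQ : ∀ j ∈ D, ‖a j‖ ≤ M * Q := fun j hj => by
    have h := hMf j (∑ j ∈ A, c j • e j + ∑ j ∈ D, a j • e j)
    rw [map_add, hb.coeff_sum, hb.coeff_sum, if_neg (Finset.disjoint_right.1 hAD hj), if_pos hj,
      zero_add] at h
    exact h.trans (by gcongr)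
  have hφD : ‖φ (∑ j ∈ D, a j • e j)‖ ≤ Q := by
    have hDw : ∑ j ∈ D, w j ≤ ∑ j ∈ A, w j + W := by
      rw [hD, Finset.sum_insert hp]
      linarith [hW p]
    have h := hN₁ D (fun j hj => (le_max_left _ _).trans (hN.trans (hDN j hj))) hDw
    calc ‖φ (∑ j ∈ D, a j • e j)‖ ≤ ∑ j ∈ D, ‖a j‖ * ‖φ (e j)‖ := by
          rw [map_sum]
          refine (norm_sum_le _ _).trans_eq (Finset.sum_congr rfl fun j _ => ?_)
          rw [map_smul, norm_smul]
      _ ≤ ∑ j ∈ D, M * Q * ‖φ (e j)‖ :=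
          Finset.sum_le_sum fun j hj => by gcongr; exact haQ j hj
      _ = M * Q * ∑ j ∈ D, ‖φ (e j)‖ := by rw [Finset.mul_sum]
      _ ≤ M * Q * (1 / M) := by gcongr
      _ = Q := by field_simp
  have hvQ : ‖v‖ ≤ 2 * Q := by
    have h1 : ‖φ v‖ = ‖v‖ := by rw [hφ, RCLike.norm_ofReal, abs_norm]
    have h2 : φ v = φ (v + ∑ j ∈ D, a j • e j) - φ (∑ j ∈ D, a j • e j) := by
      rw [map_add, add_sub_cancel_right]
    rw [← h1, h2, two_mul]
    refine (norm_sub_le _ _).trans (add_le_add ?_ hφD)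
    exact ((φ.le_of_opNorm_le hφ1 _).trans (one_mul _).le).trans ha
  have hDnorm : ‖∑ j ∈ D, e j‖ ≤ ((2 * C + 1) / (s ^ 2 / 4) + M * M) * ‖u‖ := by
    have h1 : ‖∑ j ∈ Finset.Ico N p, e j‖ ≤ (2 * C + 1) / (s ^ 2 / 4) * ‖u‖ := by
      rw [div_mul_eq_mul_div, le_div_iff₀ hs2]
      linarith
    rw [hD, Finset.sum_insert hp]
    refine (norm_add_le _ _).trans ?_
    nlinarith [hMe p]
  calc ‖v‖ ≤ 2 * Q := hvQ
    _ ≤ 2 * (C * (2 / s * (((2 * C + 1) / (s ^ 2 / 4) + M * M) * ‖u‖))) := by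
      rw [hQ]
      gcongr
    _ = _ := by ring

end WeaklyNull

section Main

variable {e : ℕ → X} {f : ℕ → X →L[𝕜] 𝕜} {w : ℕ → ℝ} {C s : ℝ}

lemma SemiGreedy.exists_bound_of_one_le_coeff [CompleteSpace X] (hsg : SemiGreedy e f w C s)
    (hb : IsMarkushevichBasis e f) (hw : ∀ i, 0 < w i) (hC : 0 < C) (hs : 0 < s) (hs1 : s ≤ 1) :
    ∃ K : ℝ, 0 < K ∧ ∀ (u : X) (A : Finset ℕ) (c : ℕ → 𝕜),
      (∀ i ∈ A, 1 ≤ ‖f i u‖) → (∀ i ∈ A, ‖c i‖ ≤ 1) → ‖∑ j ∈ A, c j • e j‖ ≤ K * ‖u‖ := by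
  suffices h : ∃ K : ℝ, 0 < K ∧ ∀ (u : X) (A : Finset ℕ) (c : ℕ → 𝕜), A.Nonempty →
      (∀ i ∈ A, 1 ≤ ‖f i u‖) → (∀ i ∈ A, ‖c i‖ ≤ 1) → ‖∑ j ∈ A, c j • e j‖ ≤ K * ‖u‖ by
    obtain ⟨K, hK, h⟩ := h
    refine ⟨K, hK, fun u A c hA hc => ?_⟩
    obtain rfl | hAne := A.eq_empty_or_nonempty
    · simpa using by positivity
    · exact h u A c hAne hA hc
  obtain ⟨M, hM1, -, hMf⟩ := hb.exists_bound
  have hM0 : 0 < M := by linarith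
  by_cases hbdd : BddAbove (Set.range w)
  · obtain ⟨W, hW⟩ := hbdd
    have hW : ∀ i, w i ≤ W := fun i => hW ⟨i, rfl⟩
    by_cases hsum : Summable w
    · obtain ⟨K, hK, hKb⟩ := hsg.exists_bound_one_add_sum hb hw hC hs
      have ht : 0 ≤ ∑' i, w i := tsum_nonneg fun i => (hw i).le
      refine ⟨K * (1 + ∑' i, w i) * M, by positivity, fun u A c hAne hA hc => ?_⟩
      have hu := one_le_mul_norm_of_one_le_coeff hMf hAne hA
      calc ‖∑ j ∈ A, c j • e j‖ ≤ K * (1 + ∑ j ∈ A, w j) := hKb A c hc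
        _ ≤ K * (1 + ∑' i, w i) := by
          gcongr
          exact hsum.sum_le_tsum A fun i _ => (hw i).le
        _ ≤ K * (1 + ∑' i, w i) * (M * ‖u‖) := le_mul_of_one_le_right (by positivity) hu
        _ = _ := by ring
    · by_cases hnull : ∀ (φ : StrongDual 𝕜 X) (b δ : ℝ), 0 < δ → ∃ N : ℕ, ∀ E : Finset ℕ,
          (∀ j ∈ E, N ≤ j) → ∑ j ∈ E, w j ≤ b → ∑ j ∈ E, ‖φ (e j)‖ < δ
      · exact hsg.exists_bound_of_weaklyNull hb hw hC hs hs1 hW hsum hnull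
      · push Not at hnull
        obtain ⟨φ, b, δ, hδ, h⟩ := hnull
        exact hsg.exists_bound_of_not_weaklyNull hb hw hC hs hs1 hδ h
  · obtain ⟨K, hK, hKb⟩ := hsg.exists_bound_of_le_single hb hw hC hs
    refine ⟨K * M, by positivity, fun u A c hAne hA hc => ?_⟩
    obtain ⟨_, ⟨i, rfl⟩, hi⟩ := not_bddAbove_iff.1 hbdd (∑ j ∈ A, w j)
    calc ‖∑ j ∈ A, c j • e j‖ ≤ K := hKb i A c hc hi.le
      _ ≤ K * (M * ‖u‖) :=
        le_mul_of_one_le_right hK.le (one_le_mul_norm_of_one_le_coeff hMf hAne hA)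
      _ = _ := by ring

lemma norm_sum_le_of_le_coeff {K : ℝ}
    (hK : ∀ (u : X) (A : Finset ℕ) (c : ℕ → 𝕜),
      (∀ i ∈ A, 1 ≤ ‖f i u‖) → (∀ i ∈ A, ‖c i‖ ≤ 1) → ‖∑ j ∈ A, c j • e j‖ ≤ K * ‖u‖)
    {α β : ℝ} (hα : 0 < α) (hβ : 0 < β) {u : X} {A : Finset ℕ} {c : ℕ → 𝕜}
    (hu : ∀ i ∈ A, α ≤ ‖f i u‖) (hc : ∀ i ∈ A, ‖c i‖ ≤ β) :
    ‖∑ j ∈ A, c j • e j‖ ≤ K * (β / α) * ‖u‖ := by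
  have hα' : ‖((α⁻¹ : ℝ) : 𝕜)‖ = α⁻¹ := by rw [RCLike.norm_ofReal, abs_of_pos (inv_pos.2 hα)]
  have hβ' : ‖((β⁻¹ : ℝ) : 𝕜)‖ = β⁻¹ := by rw [RCLike.norm_ofReal, abs_of_pos (inv_pos.2 hβ)]
  have h := hK (((α⁻¹ : ℝ) : 𝕜) • u) A (fun j => ((β⁻¹ : ℝ) : 𝕜) * c j)
    (fun i hi => by
      rw [map_smul, norm_smul, hα', inv_mul_eq_div, one_le_div hα]
      exact hu i hi)
    (fun i hi => by
      rw [norm_mul, hβ', inv_mul_eq_div, div_le_one hβ]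
      exact hc i hi)
  simp only [mul_smul] at h
  rw [← Finset.smul_sum, norm_smul, norm_smul, hα', hβ', inv_mul_le_iff₀ hβ] at h
  refine h.trans_eq ?_
  field_simp

lemma SemiGreedy.hasSum_of_wsum_msupp_ne_top [CompleteSpace X] (hsg : SemiGreedy e f w C s)
    (hb : IsMarkushevichBasis e f) (hw : ∀ i, 0 < w i) (hC : 0 < C) (hs : 0 < s) {z : X}
    (hz : wsum w (msupp f z) ≠ ⊤) : HasSum (fun j => f j z • e j) z := by
  classical
  obtain ⟨K, hK, hKb⟩ := hsg.exists_bound_one_add_sum hb hw hC hs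
  set W := (wsum w (msupp f z)).toReal with hW
  have hW0 : 0 ≤ W := ENNReal.toReal_nonneg
  have hsum : Summable fun j => f j z • e j := by
    rw [summable_iff_vanishing_norm]
    intro ε hε
    set η := ε / (2 * (K * (1 + W))) with hη
    have hη0 : 0 < η := by positivity
    refine ⟨(hb.finite_le_coeff z hη0).toFinset, fun t ht => ?_⟩
    have hlt : ∀ j ∈ t, ‖f j z‖ ≤ η := fun j hj => by
      by_contra! h
      exact Finset.disjoint_left.1 ht hj (by simpa using h.le)
    have hwt : ∑ j ∈ t with f j z ≠ 0, w j ≤ W := by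
      rw [hW, ← ENNReal.ofReal_le_iff_le_toReal hz, ← wsum_coe_finset hw]
      refine wsum_mono w fun j hj => ?_
      exact (Finset.mem_filter.1 (Finset.mem_coe.1 hj)).2
    have hηn : ‖(η : 𝕜)‖ = η := by rw [RCLike.norm_ofReal, abs_of_pos hη0]
    have hη𝕜 : (η : 𝕜) ≠ 0 := by
      rw [← norm_pos_iff, hηn]
      exact hη0
    have heq : ∑ j ∈ t, f j z • e j =
        (η : 𝕜) • ∑ j ∈ t with f j z ≠ 0, ((η : 𝕜)⁻¹ * f j z) • e j := by
      rw [Finset.smul_sum, Finset.sum_filter]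
      refine Finset.sum_congr rfl fun j _ => ?_
      split_ifs with h
      · rw [smul_smul, mul_inv_cancel_left₀ hη𝕜]
      · rw [not_not.1 h, zero_smul]
    have h := hKb {j ∈ t | f j z ≠ 0} (fun j => (η : 𝕜)⁻¹ * f j z) fun j hj => by
      rw [norm_mul, norm_inv, hηn, inv_mul_eq_div, div_le_one hη0]
      exact hlt j (Finset.mem_filter.1 hj).1
    rw [heq, norm_smul, hηn]
    calc η * ‖∑ j ∈ t with f j z ≠ 0, ((η : 𝕜)⁻¹ * f j z) • e j‖
        ≤ η * (K * (1 + W)) := by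
          refine mul_le_mul_of_nonneg_left (h.trans ?_) hη0.le
          exact mul_le_mul_of_nonneg_left (by linarith) hK.le
      _ = ε / 2 := by rw [hη]; field_simp
      _ < ε := by linarith
  convert hsum.hasSum
  refine sub_eq_zero.1 (hb.total _ fun i => ?_)
  have h1 := (f i).hasSum hsum.hasSum
  have h2 : HasSum (fun j => f i (f j z • e j)) (f i z) := by
    have h := hasSum_single (f := fun j => f i (f j z • e j)) i fun j hj => by
      simp [hb.biorth, hj.symm]
    simpa [hb.biorth] using h
  rw [map_sub, h2.unique h1, sub_self]

/-- The semi-greedy inequality extends to approximants of infinite support. -/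
lemma SemiGreedy.norm_sub_le_of_wsum_msupp_le [CompleteSpace X] (hsg : SemiGreedy e f w C s)
    (hb : IsMarkushevichBasis e f) (hw : ∀ i, 0 < w i) (hC : 0 < C) (hs : 0 < s) {x : X}
    {A : Finset ℕ} {r : ℝ}
    (h : ∀ z, (msupp f z).Finite → wsum w (msupp f z) ≤ wsum w (A : Set ℕ) → r ≤ C * ‖x - z‖)
    {z : X} (hz : wsum w (msupp f z) ≤ wsum w (A : Set ℕ)) : r ≤ C * ‖x - z‖ := by
  have hfin : wsum w (msupp f z) ≠ ⊤ := by
    rw [wsum_coe_finset hw] at hz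
    exact (hz.trans_lt ENNReal.ofReal_lt_top).ne
  have hsum := hsg.hasSum_of_wsum_msupp_ne_top hb hw hC hs hfin
  refine ge_of_tendsto' ((hsum.const_sub x).norm.const_mul C) fun t => ?_
  refine h _ (t.finite_toSet.subset (hb.msupp_sum_subset t _)) ((wsum_mono w ?_).trans hz)
  intro i hi h0
  refine hi ?_
  rw [hb.coeff_sum, h0, ite_self]

lemma SemiGreedy.exists_norm_sub_le_of_greedySet [CompleteSpace X] (hsg : SemiGreedy e f w C s)
    (hb : IsMarkushevichBasis e f) (hw : ∀ i, 0 < w i) (hC : 0 < C) (hs : 0 < s) (hs1 : s ≤ 1)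
    {t : ℝ} (ht : 0 < t) :
    ∃ K : ℝ, 0 < K ∧ ∀ (x : X) (m : ℕ) (A : Finset ℕ), GreedySet f x m t A →
      ∃ y : X, msupp f y ⊆ (A : Set ℕ) ∧
        ∀ z : X, wsum w (msupp f z) ≤ wsum w (A : Set ℕ) → ‖x - y‖ ≤ K * ‖x - z‖ := by
  classical
  obtain ⟨K, hK, hKb⟩ := hsg.exists_bound_of_one_le_coeff hb hw hC hs hs1
  refine ⟨C * (1 + K * (4 / (s * t))), by positivity, fun x m A hA => ?_⟩
  obtain ⟨k, hk, hmax⟩ := hb.exists_max_coeff x A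
  set γ := ‖f k x‖ with hγ
  obtain hγ0 | hγ0 := (norm_nonneg (f k x)).eq_or_lt
  · refine ⟨x, fun i hi => ?_, fun z _ => ?_⟩
    · by_contra hiA
      have := hmax i (by simpa using hiA)
      rw [hγ, ← hγ0, norm_le_zero_iff] at this
      exact hi this
    · rw [sub_self, norm_zero]
      positivity
  rw [← hγ] at hγ0
  set R : ℝ := 2 * γ / s with hR
  have hR0 : 0 < R := by positivity
  have hRn : ‖(R : 𝕜)‖ = R := by rw [RCLike.norm_ofReal, abs_of_pos hR0]
  set c : ℕ → 𝕜 := fun j => if ‖f j x‖ < R then (R : 𝕜) - f j x else 0 with hc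
  have hcn : ∀ j, ‖c j‖ ≤ 2 * R := fun j => by
    simp only [hc]
    split_ifs with h
    · refine (norm_sub_le _ _).trans ?_
      rw [hRn]
      linarith
    · rw [norm_zero]
      positivity
  have hcx : ∀ j, R ≤ ‖f j x + c j‖ := fun j => by
    simp only [hc]
    split_ifs with h
    · rw [add_sub_cancel, hRn]
    · rw [add_zero]
      exact not_lt.1 h
  set x' := x + ∑ j ∈ A, c j • e j with hx'
  obtain ⟨S, hS, y', hy', hle⟩ := hsg x' m
  obtain rfl : S = A := hS.eq_of_gap hA.1 fun i hi j hj => by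
    rw [hx', map_add, map_add, hb.coeff_sum, hb.coeff_sum, if_pos hi, if_neg hj, add_zero]
    calc ‖f j x‖ ≤ γ := hmax j hj
      _ < s * R := by
        rw [hR]
        field_simp
        linarith
      _ ≤ s * ‖f i x + c i‖ := by gcongr; exact hcx i
  refine ⟨y' - ∑ j ∈ S, c j • e j, fun i hi => ?_, fun z hz => ?_⟩
  · by_contra hiS
    refine hi ?_
    have h1 : f i y' = 0 := by
      by_contra h
      exact hiS (hy' h)
    rw [map_sub, h1, hb.coeff_sum, if_neg (by simpa using hiS), sub_zero]
  have hz' : msupp f (z + ∑ j ∈ S with f j z ≠ 0, c j • e j) ⊆ msupp f z := by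
    intro i hi h0
    refine hi ?_
    rw [map_add, h0, hb.coeff_sum, if_neg (by simp [h0]), add_zero]
  have hmain := hsg.norm_sub_le_of_wsum_msupp_le hb hw hC hs hle ((wsum_mono w hz').trans hz)
  have hsplit : x' - (z + ∑ j ∈ S with f j z ≠ 0, c j • e j) =
      (x - z) + ∑ j ∈ S with ¬ f j z ≠ 0, c j • e j := by
    rw [hx', ← Finset.sum_filter_add_sum_filter_not S (fun j => f j z ≠ 0)]
    abel
  have hrest : ‖∑ j ∈ S with ¬ f j z ≠ 0, c j • e j‖ ≤ K * (4 / (s * t)) * ‖x - z‖ := by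
    have h := norm_sum_le_of_le_coeff hKb (mul_pos ht hγ0) (mul_pos two_pos hR0)
      (u := x - z) (A := {j ∈ S | ¬ f j z ≠ 0}) (c := c)
      (fun i hi => by
        obtain ⟨hiS, hi0⟩ := Finset.mem_filter.1 hi
        rw [map_sub, not_not.1 hi0, sub_zero]
        exact hA.2 i hiS k hk)
      (fun i _ => hcn i)
    refine h.trans_eq ?_
    rw [hR]
    field_simp
    ring
  calc ‖x - (y' - ∑ j ∈ S, c j • e j)‖ = ‖x' - y'‖ := by
        rw [hx']
        congr 1
        abel
    _ ≤ C * (‖x - z‖ + K * (4 / (s * t)) * ‖x - z‖) := by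
        refine hmain.trans ?_
        rw [hsplit]
        gcongr
        exact (norm_add_le _ _).trans (add_le_add le_rfl hrest)
    _ = _ := by ring

end Main

/-- an s-w-semi-greedy basis is t-w-semi-greedy for every `0 < t ≤ 1`,
uniformly over all t-greedy sets and with no finiteness restriction on `supp z`. -/
theorem statement5 {𝕜 : Type*} [RCLike 𝕜] {X : Type*} [NormedAddCommGroup X]
    [NormedSpace 𝕜 X] [CompleteSpace X]
    (e : ℕ → X) (f : ℕ → X →L[𝕜] 𝕜) (hbasis : IsMarkushevichBasis e f)
    (w : ℕ → ℝ) (hw : ∀ i, 0 < w i)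
    (C s : ℝ) (hC : 0 < C) (hs0 : 0 < s) (hs1 : s ≤ 1)
    (hsg : SemiGreedy e f w C s) :
    ∀ t : ℝ, 0 < t → t ≤ 1 → ∃ K : ℝ, 0 < K ∧
      (∀ (x : X) (m : ℕ) (A : Finset ℕ), GreedySet f x m t A →
        ∃ y : X, msupp f y ⊆ (A : Set ℕ) ∧
          ∀ z : X, wsum w (msupp f z) ≤ wsum w (A : Set ℕ) → ‖x - y‖ ≤ K * ‖x - z‖) ∧
      SemiGreedy e f w K t := by
  intro t ht0 ht1
  obtain ⟨K, hK, h⟩ := hsg.exists_norm_sub_le_of_greedySet hbasis hw hC hs0 hs1 ht0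
  refine ⟨K, hK, h, fun x m => ?_⟩
  obtain ⟨A, hA⟩ := hbasis.exists_greedySet x m ht1
  obtain ⟨y, hy, hle⟩ := h x m A hA
  exact ⟨A, hA, y, hy, fun z _ hz => hle z hz⟩

end GreedyPaper
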